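/- arXiv:2601.01975 — 4 statements merged into one kernel-verified Lean document; each statement's English description precedes it below -/
import Mathlib

section
/- Let V, K be finite index sets, n = |V|, γ > 1, c_{v,k} > 0 for all v, k, and Q ∈ ℝ_+^{V×K}. For x ∈ ℝ_+^V set T(x) = diag(x)·Q (so T(x)_{v,k} = x_v·Q_{v,k}), and let S*(x) be the unique minimizer of the production cost c_s(S) = Σ_{v,k} (1/γ)·c_{v,k}·(S_{v,k})^γ over {S ∈ ℝ_+^{V×K} : 𝟙ᵀS = 𝟙ᵀT(x)} (which exists and is unique since the feasible set is nonempty, closed and convex, and c_s is strictly convex and coercive). Then S* is SRC on ℝ_+^V \ {0}: for every sequence (x^l)_{l∈ℕ} in ℝ_+^V with x^l ≥ x^∞ componentwise for all l and x^l → x^∞ ≠ 0, one has S*(x^l) → S*(x^∞). -/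
open Filter

/-- `S` minimizes the cost `cs` over the feasible set `Feas`. -/
def IsMinimizer {M : Type*} (cs : M → ℝ) (Feas : Set M) (S : M) : Prop :=
  S ∈ Feas ∧ ∀ S' ∈ Feas, cs S ≤ cs S'

/-- The production cost `c_s(S) = Σ_v Σ_k (1/γ)·c_{v,k}·(S_{v,k})^γ`. -/
noncomputable def prodCost {V K : Type*} [Fintype V] [Fintype K]
    (γ : ℝ) (c : V → K → ℝ) (S : Matrix V K ℝ) : ℝ :=
  ∑ v, ∑ k, (1/γ) * c v k * (S v k) ^ γ

/-- The balance feasible set: nonnegative matrices whose column sums agree with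
those of `T` (i.e. `𝟙ᵀS = 𝟙ᵀT`). -/
def balFeas {V K : Type*} [Fintype V] [Fintype K] (T : Matrix V K ℝ) :
    Set (Matrix V K ℝ) :=
  {S | (∀ v k, 0 ≤ S v k) ∧ ∀ k, ∑ v, S v k = ∑ v, T v k}

/-- The tangent line inequality for `s ↦ s ^ γ` on the nonnegative reals, strict away from the
point of tangency. -/
lemma rpow_tangent_lt {γ s a : ℝ} (hγ : 1 < γ) (hs : 0 ≤ s) (ha : 0 ≤ a) (h : s ≠ a) :
    a ^ γ + γ * a ^ (γ - 1) * (s - a) < s ^ γ := by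
  rcases ha.eq_or_lt with rfl | ha'
  · rw [Real.zero_rpow (by linarith), Real.zero_rpow (by linarith)]
    simpa using Real.rpow_pos_of_pos (lt_of_le_of_ne hs h.symm) γ
  · have hu : s / a - 1 ≠ 0 := by
      rw [sub_ne_zero, Ne, div_eq_one_iff_eq ha'.ne']
      exact h
    have hu' : -1 ≤ s / a - 1 := by linarith [div_nonneg hs ha]
    have key := one_add_mul_self_lt_rpow_one_add hu' hu hγ
    rw [add_sub_cancel, Real.div_rpow hs ha, lt_div_iff₀ (Real.rpow_pos_of_pos ha' γ)] at key
    have hpow : a ^ γ = a ^ (γ - 1) * a := by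
      rw [Real.rpow_sub_one ha'.ne', div_mul_cancel₀ _ ha'.ne']
    calc a ^ γ + γ * a ^ (γ - 1) * (s - a)
        = (1 + γ * (s / a - 1)) * a ^ γ := by rw [hpow]; field_simp
      _ < s ^ γ := key

lemma rpow_tangent_le {γ s a : ℝ} (hγ : 1 < γ) (hs : 0 ≤ s) (ha : 0 ≤ a) :
    a ^ γ + γ * a ^ (γ - 1) * (s - a) ≤ s ^ γ := by
  by_cases h : s = a
  · simp [h]
  · exact (rpow_tangent_lt hγ hs ha h).le

/-- A feasible point whose marginal costs are constant along each column is strictly cheaper than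
every other feasible point. -/
lemma prodCost_lt_of_marginal_eq {V K : Type*} [Fintype V] [Fintype K]
    {γ : ℝ} (hγ : 1 < γ) {c : V → K → ℝ} (hc : ∀ v k, 0 < c v k)
    {T A S : Matrix V K ℝ} (hA : A ∈ balFeas T) (μ : K → ℝ)
    (hμ : ∀ v k, c v k * A v k ^ (γ - 1) = μ k) (hS : S ∈ balFeas T) (hne : S ≠ A) :
    prodCost γ c A < prodCost γ c S := by
  have hγ0 : 0 < γ := by linarith
  have hlin : ∑ v, ∑ k, μ k * (S v k - A v k) = 0 := by
    rw [Finset.sum_comm]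
    refine Finset.sum_eq_zero fun k _ => ?_
    rw [← Finset.mul_sum, Finset.sum_sub_distrib, hS.2 k, hA.2 k, sub_self, mul_zero]
  have hexpand : ∀ v k, (1 / γ) * c v k * A v k ^ γ + μ k * (S v k - A v k) =
      (1 / γ) * c v k * (A v k ^ γ + γ * A v k ^ (γ - 1) * (S v k - A v k)) := by
    intro v k
    rw [← hμ v k]
    field_simp
  have hcoef : ∀ v k, 0 < (1 / γ) * c v k := fun v k => mul_pos (by positivity) (hc v k)
  have hle : ∀ v k, (1 / γ) * c v k * A v k ^ γ + μ k * (S v k - A v k) ≤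
      (1 / γ) * c v k * S v k ^ γ := by
    intro v k
    rw [hexpand]
    exact mul_le_mul_of_nonneg_left (rpow_tangent_le hγ (hS.1 v k) (hA.1 v k)) (hcoef v k).le
  obtain ⟨v₀, k₀, h₀⟩ : ∃ v k, S v k ≠ A v k := by
    by_contra! h
    exact hne (Matrix.ext h)
  calc prodCost γ c A
      = ∑ v, ∑ k, ((1 / γ) * c v k * A v k ^ γ + μ k * (S v k - A v k)) := by
        simp only [Finset.sum_add_distrib, hlin, add_zero, prodCost]
    _ < prodCost γ c S := by
        refine Finset.sum_lt_sum (fun v _ => Finset.sum_le_sum fun k _ => hle v k)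
          ⟨v₀, Finset.mem_univ _, Finset.sum_lt_sum (fun k _ => hle v₀ k)
            ⟨k₀, Finset.mem_univ _, ?_⟩⟩
        rw [hexpand]
        exact mul_lt_mul_of_pos_left (rpow_tangent_lt hγ (hS.1 _ _) (hA.1 _ _) h₀) (hcoef _ _)

/-- The minimizer in closed form: column `k` splits its total `∑ v, T v k` proportionally to
`c v k ^ (-1 / (γ - 1))`. -/
noncomputable def balMinimizer {V K : Type*} [Fintype V]
    (γ : ℝ) (c : V → K → ℝ) (T : Matrix V K ℝ) : Matrix V K ℝ :=
  Matrix.of fun v k =>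
    (∑ u, T u k) / (∑ u, c u k ^ (-1 / (γ - 1))) * c v k ^ (-1 / (γ - 1))

lemma balMinimizer_mem {V K : Type*} [Fintype V] [Fintype K]
    {γ : ℝ} {c : V → K → ℝ} (hc : ∀ v k, 0 < c v k)
    {T : Matrix V K ℝ} (hT : ∀ v k, 0 ≤ T v k) : balMinimizer γ c T ∈ balFeas T := by
  have hpos : ∀ v k, 0 < c v k ^ (-1 / (γ - 1)) := fun v k => Real.rpow_pos_of_pos (hc v k) _
  refine ⟨fun v k => mul_nonneg (div_nonneg (Finset.sum_nonneg fun u _ => hT u k)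
    (Finset.sum_nonneg fun u _ => (hpos u k).le)) (hpos v k).le, fun k => ?_⟩
  simp only [balMinimizer, Matrix.of_apply]
  rw [← Finset.mul_sum]
  cases isEmpty_or_nonempty V
  · simp
  · exact div_mul_cancel₀ _ (Finset.sum_pos (fun u _ => hpos u k) Finset.univ_nonempty).ne'

lemma balMinimizer_marginal {V K : Type*} [Fintype V]
    {γ : ℝ} (hγ : 1 < γ) {c : V → K → ℝ} (hc : ∀ v k, 0 < c v k)
    {T : Matrix V K ℝ} (hT : ∀ v k, 0 ≤ T v k) (v : V) (k : K) :
    c v k * balMinimizer γ c T v k ^ (γ - 1) =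
      ((∑ u, T u k) / (∑ u, c u k ^ (-1 / (γ - 1)))) ^ (γ - 1) := by
  have hpos : ∀ v k, 0 < c v k ^ (-1 / (γ - 1)) := fun v k => Real.rpow_pos_of_pos (hc v k) _
  have hγ1 : γ - 1 ≠ 0 := by linarith
  simp only [balMinimizer, Matrix.of_apply]
  rw [Real.mul_rpow (div_nonneg (Finset.sum_nonneg fun u _ => hT u k)
    (Finset.sum_nonneg fun u _ => (hpos u k).le)) (hpos v k).le, ← Real.rpow_mul (hc v k).le,
    div_mul_cancel₀ _ hγ1, Real.rpow_neg_one, mul_left_comm, mul_inv_cancel₀ (hc v k).ne', mul_one]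

lemma isMinimizer_iff_eq_balMinimizer {V K : Type*} [Fintype V] [Fintype K]
    {γ : ℝ} (hγ : 1 < γ) {c : V → K → ℝ}
    (hc : ∀ v k, 0 < c v k) {T : Matrix V K ℝ} (hT : ∀ v k, 0 ≤ T v k) {S : Matrix V K ℝ} :
    IsMinimizer (prodCost γ c) (balFeas T) S ↔ S = balMinimizer γ c T := by
  have hmem := balMinimizer_mem (γ := γ) hc hT
  have hlt : ∀ S' ∈ balFeas T, S' ≠ balMinimizer γ c T →
      prodCost γ c (balMinimizer γ c T) < prodCost γ c S' := fun S' =>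
    prodCost_lt_of_marginal_eq hγ hc hmem _ (balMinimizer_marginal hγ hc hT)
  constructor
  · intro h
    by_contra hne
    exact (hlt S h.1 hne).not_ge (h.2 _ hmem)
  · rintro rfl
    refine ⟨hmem, fun S' hS' => ?_⟩
    by_cases hne : S' = balMinimizer γ c T
    · rw [hne]
    · exact (hlt S' hS' hne).le

lemma continuous_balMinimizer {V K : Type*} [Fintype V]
    (γ : ℝ) (c : V → K → ℝ) :
    Continuous (balMinimizer γ c : Matrix V K ℝ → Matrix V K ℝ) := by
  refine continuous_matrix fun v k => ?_
  simp only [balMinimizer, Matrix.of_apply]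
  exact ((continuous_finsetSum _ fun u _ => continuous_id.matrix_elem u k).div_const _).mul_const _

/-- With `T(x) = diag(x)·Q`, the production cost attains a unique
minimizer `S*(x)` over `{S ≥ 0 : 𝟙ᵀS = 𝟙ᵀT(x)}` for each `x ∈ ℝ_+^V`, and the map
`S*` is sequentially right continuous on `ℝ_+^V \ {0}`: for any sequence
`x^l ≥ x^∞` componentwise with `x^l → x^∞ ≠ 0`, one has `S*(x^l) → S*(x^∞)`. -/
theorem stmt8
    {V K : Type*} [Fintype V] [Fintype K]
    (γ : ℝ) (hγ : 1 < γ) (c : V → K → ℝ) (hc : ∀ v k, 0 < c v k)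
    (Q : Matrix V K ℝ) (hQ : ∀ v k, 0 ≤ Q v k) :
    (∀ x : V → ℝ, (∀ v, 0 ≤ x v) →
      ∃! S : Matrix V K ℝ,
        IsMinimizer (prodCost γ c) (balFeas (Matrix.of fun v k => x v * Q v k)) S)
    ∧ ∀ Sstar : (V → ℝ) → Matrix V K ℝ,
        (∀ x : V → ℝ, (∀ v, 0 ≤ x v) →
          IsMinimizer (prodCost γ c) (balFeas (Matrix.of fun v k => x v * Q v k)) (Sstar x) ∧
          ∀ S' : Matrix V K ℝ,
            IsMinimizer (prodCost γ c) (balFeas (Matrix.of fun v k => x v * Q v k)) S' →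
              S' = Sstar x) →
        ∀ (xl : ℕ → (V → ℝ)) (xinf : V → ℝ),
          (∀ l v, 0 ≤ xl l v) → (∀ l v, xinf v ≤ xl l v) →
          (∀ v, 0 ≤ xinf v) → xinf ≠ 0 →
          Tendsto xl atTop (nhds xinf) →
          Tendsto (fun l => Sstar (xl l)) atTop (nhds (Sstar xinf)) := by
  have hT : ∀ x : V → ℝ, (∀ v, 0 ≤ x v) →
      ∀ v k, 0 ≤ (Matrix.of fun v k => x v * Q v k) v k :=
    fun x hx v k => mul_nonneg (hx v) (hQ v k)
  refine ⟨fun x hx => ?_, fun Sstar hS xl xinf hxl _ hxinf _ hlim => ?_⟩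
  · simp only [isMinimizer_iff_eq_balMinimizer hγ hc (hT x hx), existsUnique_eq]
  · have hSstar : ∀ x : V → ℝ, (∀ v, 0 ≤ x v) →
        Sstar x = balMinimizer γ c (Matrix.of fun v k => x v * Q v k) := fun x hx =>
      (isMinimizer_iff_eq_balMinimizer hγ hc (hT x hx)).1 (hS x hx).1
    have hcont : Continuous fun x : V → ℝ => (Matrix.of fun v k => x v * Q v k : Matrix V K ℝ) :=
      continuous_matrix fun v k => (continuous_apply v).mul_const _
    rw [hSstar xinf hxinf]
    simp only [hSstar (xl _) (hxl _)]
    exact (((continuous_balMinimizer γ c).comp hcont).tendsto xinf).comp hlim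
end

section
/- Let V, E, K be finite index sets with |V| = n. Let B ∈ ℝ^{V×E} satisfy Bᵀ𝟙 = 0 (every column of B sums to zero) and ker(Bᵀ) = ℝ·𝟙 (the kernel of Bᵀ is exactly the span of the all-ones vector). Let S ∈ ℝ^{E×E} be a diagonal matrix with strictly positive diagonal entries, set L = B·S·Bᵀ, and let M ∈ ℝ^{V×V} satisfy the Moore–Penrose equations for L: L·M·L = L, M·L·M = M, (L·M)ᵀ = L·M, and (M·L)ᵀ = M·L. Let U ∈ ℝ^{V×K} satisfy 𝟙ᵀU = 0 (every column of U sums to zero). Then the matrix F = S·Bᵀ·M·U is the unique minimizer of the cost c(F') = Σ_{e∈E} Σ_{k∈K} (F'_{e,k})² / (2·S_{e,e}) over all F' ∈ ℝ^{E×K} with B·F' = U. -/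
open Matrix in
/-- For a positive diagonal weight `s`, the kernel of `B * diagonal s * Bᵀ` is the kernel of `Bᵀ`. -/
lemma transpose_mulVec_eq_zero_of_mul_diagonal_mul_transpose
    {V E : Type*} [Fintype V] [Fintype E] [DecidableEq E] (B : Matrix V E ℝ) {s : E → ℝ}
    (hs : ∀ e, 0 < s e) {x : V → ℝ} (hx : (B * diagonal s * Bᵀ) *ᵥ x = 0) : Bᵀ *ᵥ x = 0 := by
  have h : ∑ e, s e * (Bᵀ *ᵥ x) e ^ 2 = 0 := calc
    ∑ e, s e * (Bᵀ *ᵥ x) e ^ 2 = (Bᵀ *ᵥ x) ⬝ᵥ (diagonal s *ᵥ (Bᵀ *ᵥ x)) := by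
      simp only [dotProduct, mulVec_diagonal]
      exact Finset.sum_congr rfl fun e _ => by ring
    _ = x ⬝ᵥ ((B * diagonal s * Bᵀ) *ᵥ x) := by
      rw [← mulVec_mulVec, ← mulVec_mulVec, dotProduct_mulVec x B, mulVec_transpose]
    _ = 0 := by rw [hx, dotProduct_zero]
  have hnn : ∀ e ∈ Finset.univ, 0 ≤ s e * (Bᵀ *ᵥ x) e ^ 2 := fun e _ =>
    mul_nonneg (hs e).le (sq_nonneg _)
  ext e
  have he := (Finset.sum_eq_zero_iff_of_nonneg hnn).1 h e (Finset.mem_univ e)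
  simpa [(hs e).ne'] using he

open Matrix in
/-- If the kernel of the symmetric matrix `L` consists of constant vectors and `L * M` is a
symmetric projection onto the range of `L`, then `L * M` fixes matrices with zero column sums. -/
lemma mul_mul_eq_self_of_sum_eq_zero
    {V K : Type*} [Fintype V] {L M : Matrix V V ℝ} (hLs : Lᵀ = L)
    (hker : ∀ x : V → ℝ, L *ᵥ x = 0 → ∃ c : ℝ, x = fun _ => c)
    (hLML : L * M * L = L) (hLM : (L * M)ᵀ = L * M)
    {U : Matrix V K ℝ} (hU : ∀ k, ∑ v, U v k = 0) : L * M * U = U := by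
  classical
  have hLP : L * (1 - L * M) = 0 := by
    have h := congrArg transpose hLML
    rw [transpose_mul, hLM, hLs] at h
    rw [mul_sub, mul_one, h, sub_self]
  have hsymm : (1 - L * M)ᵀ = 1 - L * M := by rw [transpose_sub, hLM, transpose_one]
  have hconst : ∀ v, ∃ c : ℝ, (1 - L * M) v = fun _ => c := fun v => by
    refine hker _ ?_
    ext w
    have h := congrFun (congrFun hLP w) v
    rw [← hsymm] at h
    exact h
  have hzero : (1 - L * M) * U = 0 := by
    ext v k
    obtain ⟨c, hc⟩ := hconst v
    rw [mul_apply, hc, ← Finset.mul_sum, hU, mul_zero, Matrix.zero_apply]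
  rw [Matrix.sub_mul, Matrix.one_mul, sub_eq_zero] at hzero
  exact hzero.symm

open Matrix in
/-- A potential flow `diagonal s * Bᵀ * Y` is the strict minimizer of the weighted quadratic cost
among all flows with the same divergence. -/
lemma sum_sq_div_lt_of_potential_flow
    {V E K : Type*} [Fintype V] [Fintype E] [Fintype K] [DecidableEq E] (B : Matrix V E ℝ)
    {s : E → ℝ} (hs : ∀ e, 0 < s e) (Y : Matrix V K ℝ) {F F' : Matrix E K ℝ}
    (hF : F = diagonal s * (Bᵀ * Y)) (hne : F' ≠ F) (hdiv : B * F' = B * F) :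
    ∑ e, ∑ k, F e k ^ 2 / (2 * s e) < ∑ e, ∑ k, F' e k ^ 2 / (2 * s e) := by
  have hcross : ∑ e, ∑ k, (Bᵀ * Y) e k * (F' - F) e k = 0 := by
    calc ∑ e, ∑ k, (Bᵀ * Y) e k * (F' - F) e k = trace ((Bᵀ * Y) * (F' - F)ᵀ) := by
          simp only [trace, diag, mul_apply (M := Bᵀ * Y), transpose_apply]
      _ = trace ((B * (F' - F))ᵀ * Y) := by
          rw [transpose_mul, trace_mul_comm, Matrix.mul_assoc]
      _ = 0 := by rw [Matrix.mul_sub, hdiv, sub_self, transpose_zero, Matrix.zero_mul, trace_zero]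
  have hexpand : ∀ e k, F' e k ^ 2 / (2 * s e) = F e k ^ 2 / (2 * s e) +
      (Bᵀ * Y) e k * (F' - F) e k + (F' - F) e k ^ 2 / (2 * s e) := fun e k => by
    have hFe : F e k = s e * (Bᵀ * Y) e k := by rw [hF, diagonal_mul]
    have := (hs e).ne'
    rw [Matrix.sub_apply, hFe]
    field_simp
    ring
  have hnn : ∀ e k, 0 ≤ (F' - F) e k ^ 2 / (2 * s e) := fun e k =>
    div_nonneg (sq_nonneg _) (mul_pos two_pos (hs e)).le
  have hpos : 0 < ∑ e, ∑ k, (F' - F) e k ^ 2 / (2 * s e) := by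
    obtain ⟨e, k, hek⟩ : ∃ e k, F' e k ≠ F e k := by
      by_contra! h
      exact hne (Matrix.ext h)
    refine Finset.sum_pos' (fun e _ => Finset.sum_nonneg fun k _ => hnn e k)
      ⟨e, Finset.mem_univ e, Finset.sum_pos' (fun k _ => hnn e k) ⟨k, Finset.mem_univ k, ?_⟩⟩
    exact div_pos (sq_pos_of_ne_zero (sub_ne_zero.2 hek)) (mul_pos two_pos (hs e))
  simp only [hexpand, Finset.sum_add_distrib, hcross]
  linarith

/-- **DC power flow is the minimal-cost flow.** With `B` an incidence-type
matrix (`Bᵀ𝟙 = 0`, `ker Bᵀ = ℝ·𝟙`), `S` diagonal with positive entries, `L = B·S·Bᵀ`,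
`M` the Moore–Penrose pseudoinverse of `L`, and `U` with zero column sums, the matrix
`F = S·Bᵀ·M·U` is the unique minimizer of `c(F') = Σ_{e,k} (F'_{e,k})²/(2·S_{e,e})`
over `{F' : B·F' = U}`. -/
theorem stmt11
    {V E K : Type*} [Fintype V] [Fintype E] [Fintype K]
    (B : Matrix V E ℝ)
    (hBcol : ∀ e, ∑ v, B v e = 0)
    (hBker : ∀ x : V → ℝ, B.transpose.mulVec x = 0 ↔ ∃ cc : ℝ, x = fun _ => cc)
    (S : Matrix E E ℝ)
    (hSdiag : ∀ e e', e ≠ e' → S e e' = 0) (hSpos : ∀ e, 0 < S e e)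
    (L : Matrix V V ℝ) (hL : L = B * S * B.transpose)
    (M : Matrix V V ℝ)
    (hMP1 : L * M * L = L) (hMP2 : M * L * M = M)
    (hMP3 : (L * M).transpose = L * M) (hMP4 : (M * L).transpose = M * L)
    (U : Matrix V K ℝ) (hU : ∀ k, ∑ v, U v k = 0)
    (F : Matrix E K ℝ) (hF : F = S * B.transpose * M * U) :
    B * F = U ∧
    ∀ F' : Matrix E K ℝ, F' ≠ F → B * F' = U →
      (∑ e, ∑ k, (F e k) ^ 2 / (2 * S e e)) < ∑ e, ∑ k, (F' e k) ^ 2 / (2 * S e e) := by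
  classical
  obtain ⟨s, rfl⟩ : ∃ s : E → ℝ, S = Matrix.diagonal s :=
    ⟨S.diag, Matrix.ext fun e e' => by
      by_cases h : e = e'
      · subst h; simp
      · rw [hSdiag e e' h, Matrix.diagonal_apply_ne _ h]⟩
  simp only [Matrix.diagonal_apply_eq] at hSpos ⊢
  have hLs : L.transpose = L := by
    simp [hL, Matrix.transpose_mul, Matrix.mul_assoc]
  have hBF : B * F = U := by
    have hker : ∀ x : V → ℝ, L.mulVec x = 0 → ∃ c : ℝ, x = fun _ => c := fun x hx =>
      (hBker x).1 (transpose_mulVec_eq_zero_of_mul_diagonal_mul_transpose B hSpos (hL ▸ hx))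
    have h := mul_mul_eq_self_of_sum_eq_zero hLs hker hMP1 hMP3 hU
    rw [hL] at h
    simpa only [hF, Matrix.mul_assoc] using h
  exact ⟨hBF, fun F' hne hF' => sum_sq_div_lt_of_potential_flow B hSpos (M * U)
    (by simp only [hF, Matrix.mul_assoc]) hne (hF'.trans hBF.symm)⟩
end

section
/- Let B ∈ ℝ^{4×6} be the oriented incidence matrix of the complete graph K₄ with edges ordered (1,2), (1,3), (1,4), (2,3), (2,4), (3,4), where each edge is directed toward the smaller-index vertex: row 1 of B is (1, 1, 1, 0, 0, 0), row 2 is (−1, 0, 0, 1, 1, 0), row 3 is (0, −1, 0, −1, 0, 1), and row 4 is (0, 0, −1, 0, −1, −1). Then the vector f = ((5 − √5)/8, (5 − √5)/8, (√5 − 1)/4, 0, (1 − √5)/8, (1 − √5)/8) is the unique minimizer of the cost c(f') = Σ_{e=1}^6 (1/3)·|f'_e|³ over all f' ∈ ℝ⁶ with B·f' = (1, −1/2, −1/2, 0)ᵀ. -/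
/-- The oriented incidence matrix of `K₄` with edges ordered
`(1,2), (1,3), (1,4), (2,3), (2,4), (3,4)`, each edge directed toward the
smaller-index vertex. -/
def K4IncidenceMatrix : Matrix (Fin 4) (Fin 6) ℝ :=
  !![1, 1, 1, 0, 0, 0;
     -1, 0, 0, 1, 1, 0;
     0, -1, 0, -1, 0, 1;
     0, 0, -1, 0, -1, -1]

/-- The candidate optimal flow
`f = ((5 − √5)/8, (5 − √5)/8, (√5 − 1)/4, 0, (1 − √5)/8, (1 − √5)/8)`. -/
noncomputable def optFlow15 : Fin 6 → ℝ :=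
  ![(5 - Real.sqrt 5) / 8, (5 - Real.sqrt 5) / 8, (Real.sqrt 5 - 1) / 4,
    0, (1 - Real.sqrt 5) / 8, (1 - Real.sqrt 5) / 8]

/-- The cubic `|x|³` lies strictly above each of its tangent lines away from the point of tangency. -/
theorem abs_cube_tangent_lt {a x : ℝ} (h : x ≠ a) :
    (1/3 : ℝ) * |a| ^ 3 + a * |a| * (x - a) < (1/3 : ℝ) * |x| ^ 3 := by
  have hd : 0 < (x - a) ^ 2 := by
    have := sub_ne_zero.mpr h
    positivity
  rcases le_total 0 a with ha | ha <;> rcases le_total 0 x with hx | hx <;>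
    simp only [abs_of_nonneg, abs_of_nonpos, ha, hx]
  · have hs : 0 < x + 2 * a := by
      by_contra! hc
      exact h (by linarith)
    nlinarith [mul_pos hd hs]
  · have h1 : 0 ≤ a ^ 3 := by positivity
    have h2 : 0 ≤ (-x) ^ 3 := pow_nonneg (by linarith) 3
    have h3 : 0 ≤ a ^ 2 * (-x) := mul_nonneg (sq_nonneg a) (by linarith)
    rcases ha.eq_or_lt with rfl | ha
    · have : 0 < (-x) ^ 3 := pow_pos (neg_pos.mpr (lt_of_le_of_ne hx h)) 3
      nlinarith
    · have : 0 < a ^ 3 := by positivity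
      nlinarith
  · have h1 : 0 ≤ (-a) ^ 3 := pow_nonneg (by linarith) 3
    have h2 : 0 ≤ x ^ 3 := by positivity
    have h3 : 0 ≤ a ^ 2 * x := by positivity
    rcases ha.eq_or_lt with rfl | ha
    · have : 0 < x ^ 3 := pow_pos (lt_of_le_of_ne hx h.symm) 3
      nlinarith
    · have : 0 < (-a) ^ 3 := pow_pos (by linarith) 3
      nlinarith
  · have hs : 0 < -x + 2 * -a := by
      by_contra! hc
      exact h (by linarith)
    nlinarith [mul_pos hd hs]

theorem abs_cube_tangent_le (a x : ℝ) :
    (1/3 : ℝ) * |a| ^ 3 + a * |a| * (x - a) ≤ (1/3 : ℝ) * |x| ^ 3 := by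
  rcases eq_or_ne x a with rfl | h
  · simp
  · exact (abs_cube_tangent_lt h).le

/-- The gradient of the cost at `optFlow15` is a potential difference, so it annihilates the
differences of flows with the same demand. -/
theorem sum_gradient_eq_zero {f : Fin 6 → ℝ}
    (hf : K4IncidenceMatrix.mulVec f = ![1, -1/2, -1/2, 0]) :
    ∑ e, optFlow15 e * |optFlow15 e| * (f e - optFlow15 e) = 0 := by
  have h5 : Real.sqrt 5 ^ 2 = 5 := Real.sq_sqrt (by norm_num)
  have hlo : 1 ≤ Real.sqrt 5 := Real.one_le_sqrt.mpr (by norm_num)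
  have hhi : Real.sqrt 5 ≤ 5 := by nlinarith
  have h0 := congrFun hf 0
  have h1 := congrFun hf 1
  have h2 := congrFun hf 2
  have h3 := congrFun hf 3
  simp [K4IncidenceMatrix, Matrix.mulVec, dotProduct, Fin.sum_univ_succ] at h0 h1 h2 h3
  simp only [optFlow15, Fin.sum_univ_six, Matrix.cons_val]
  rw [abs_of_nonneg (show 0 ≤ (5 - Real.sqrt 5) / 8 by linarith),
    abs_of_nonneg (show 0 ≤ (Real.sqrt 5 - 1) / 4 by linarith),
    abs_of_nonpos (show (1 - Real.sqrt 5) / 8 ≤ 0 by linarith)]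
  have e0 : f 0 = 1 / 2 + f 3 + f 4 := by linarith
  have e1 : f 1 = 1 / 2 - f 3 + f 5 := by linarith
  have e2 : f 2 = -f 4 - f 5 := by linarith
  rw [e0, e1, e2]
  linear_combination (-(f 4 + f 5 + (Real.sqrt 5 - 1) / 4) / 16) * h5

/-- The vector `optFlow15` is the unique minimizer of
`c(f') = Σ_e (1/3)·|f'_e|³` over all `f'` with `B·f' = (1, −1/2, −1/2, 0)ᵀ`,
where `B` is the oriented incidence matrix of `K₄`. -/
theorem stmt15 :
    K4IncidenceMatrix.mulVec optFlow15 = ![1, -1/2, -1/2, 0] ∧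
    ∀ f' : Fin 6 → ℝ, f' ≠ optFlow15 →
      K4IncidenceMatrix.mulVec f' = ![1, -1/2, -1/2, 0] →
      (∑ e, (1/3 : ℝ) * |optFlow15 e| ^ 3) < ∑ e, (1/3 : ℝ) * |f' e| ^ 3 := by
  refine ⟨?_, fun f hne hf => ?_⟩
  · ext i
    fin_cases i <;>
      simp [K4IncidenceMatrix, optFlow15, Matrix.mulVec, dotProduct, Fin.sum_univ_succ] <;> ring
  · obtain ⟨i, hi⟩ := Function.ne_iff.mp hne
    have hlt := Finset.sum_lt_sum (fun e _ => abs_cube_tangent_le (optFlow15 e) (f e))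
      ⟨i, Finset.mem_univ i, abs_cube_tangent_lt hi⟩
    rwa [Finset.sum_add_distrib, sum_gradient_eq_zero hf, add_zero] at hlt
end

section
/- Let B ∈ ℝ^{4×6} be the oriented incidence matrix of the complete graph K₄ with edges ordered (1,2), (1,3), (1,4), (2,3), (2,4), (3,4), where each edge is directed toward the smaller-index vertex: row 1 of B is (1, 1, 1, 0, 0, 0), row 2 is (−1, 0, 0, 1, 1, 0), row 3 is (0, −1, 0, −1, 0, 1), and row 4 is (0, 0, −1, 0, −1, −1). For u ∈ ℝ⁴ in the range of B, let f*(u) denote the unique minimizer of c(f') = Σ_{e=1}^6 (1/3)·|f'_e|³ over {f' ∈ ℝ⁶ : B·f' = u}. Set U₁ = (1, −1, 0, 0)ᵀ and U₂ = (1, 0, −1, 0)ᵀ. Then the map u ↦ |f*(u)| fails quasi-convexity at the midpoint: for the third coordinate (edge (1,4)) one has |f*((U₁ + U₂)/2)₃| = (√5 − 1)/4 > 1 − √2/2 = max{ |f*(U₁)₃|, |f*(U₂)₃| }. -/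
/-- First-order convexity inequality for `x ↦ |x|³ / 3`. -/
lemma third_mul_abs_cube_add_le (a b : ℝ) :
    (1/3 : ℝ) * |a| ^ 3 + a * |a| * (b - a) ≤ (1/3 : ℝ) * |b| ^ 3 := by
  have hab : a * b ≤ |a| * |b| := by rw [← abs_mul]; exact le_abs_self _
  have hsq : a * a = |a| * |a| := (abs_mul_abs_self a).symm
  have ha := abs_nonneg a
  have hb := abs_nonneg b
  have hmul : |a| * (a * b) ≤ |a| * (|a| * |b|) := mul_le_mul_of_nonneg_left hab ha
  have hcube : a * |a| * (b - a) = |a| * (a * b) - |a| ^ 3 := by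
    linear_combination (-|a|) * hsq
  nlinarith [mul_nonneg (add_nonneg hb (add_nonneg ha ha)) (sq_nonneg (|b| - |a|))]

/-- A flow whose edge values satisfy `f_e |f_e| = (Bᵀ p)_e` for some vertex potential `p`
has minimal cubic cost among the flows with the same divergence. -/
lemma sum_abs_cube_le_of_potential {m n : Type*} [Fintype m] [Fintype n]
    (B : Matrix m n ℝ) (f g : n → ℝ) (p : m → ℝ)
    (hfp : ∀ e, f e * |f e| = Matrix.vecMul p B e) (hfg : B.mulVec g = B.mulVec f) :
    (∑ e, (1/3 : ℝ) * |f e| ^ 3) ≤ ∑ e, (1/3 : ℝ) * |g e| ^ 3 := by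
  have horth : ∑ e, f e * |f e| * (g e - f e) = 0 := by
    have h : Matrix.vecMul p B ⬝ᵥ (g - f) = 0 := by
      rw [← Matrix.dotProduct_mulVec, Matrix.mulVec_sub, hfg, sub_self, dotProduct_zero]
    simpa [dotProduct, hfp] using h
  calc (∑ e, (1/3 : ℝ) * |f e| ^ 3)
      = ∑ e, ((1/3 : ℝ) * |f e| ^ 3 + f e * |f e| * (g e - f e)) := by
        rw [Finset.sum_add_distrib, horth, add_zero]
    _ ≤ ∑ e, (1/3 : ℝ) * |g e| ^ 3 :=
        Finset.sum_le_sum fun e _ => third_mul_abs_cube_add_le (f e) (g e)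

/-- **Failure of quasi-convexity in `K₄`.** Let `f*` send each `u`
in the range of `B·` to the unique minimizer of `c(f') = Σ_e (1/3)·|f'_e|³` over
`{f' : B·f' = u}`. With `U₁ = (1, −1, 0, 0)ᵀ` and `U₂ = (1, 0, −1, 0)ᵀ`, the map
`u ↦ |f*(u)|` fails quasi-convexity at the midpoint in the third coordinate
(edge `(1,4)`): `|f*((U₁+U₂)/2)₃| = (√5 − 1)/4 > 1 − √2/2 = max{|f*(U₁)₃|, |f*(U₂)₃|}`. -/
theorem stmt16
    (fstar : (Fin 4 → ℝ) → (Fin 6 → ℝ))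
    (hfstar : ∀ u ∈ Set.range K4IncidenceMatrix.mulVec,
      K4IncidenceMatrix.mulVec (fstar u) = u ∧
      ∀ g : Fin 6 → ℝ, g ≠ fstar u → K4IncidenceMatrix.mulVec g = u →
        (∑ e, (1/3 : ℝ) * |fstar u e| ^ 3) < ∑ e, (1/3 : ℝ) * |g e| ^ 3) :
    |fstar ((2 : ℝ)⁻¹ • ((![1, -1, 0, 0] : Fin 4 → ℝ) + ![1, 0, -1, 0])) 2|
        = (Real.sqrt 5 - 1) / 4 ∧
    (Real.sqrt 5 - 1) / 4 > 1 - Real.sqrt 2 / 2 ∧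
    1 - Real.sqrt 2 / 2
        = max |fstar ![1, -1, 0, 0] 2| |fstar ![1, 0, -1, 0] 2| := by
  have key : ∀ (u : Fin 4 → ℝ) (f : Fin 6 → ℝ) (p : Fin 4 → ℝ),
      K4IncidenceMatrix.mulVec f = u →
      (∀ e, f e * |f e| = Matrix.vecMul p K4IncidenceMatrix e) → fstar u = f := by
    intro u f p hf hp
    obtain ⟨hu, hmin⟩ := hfstar u ⟨f, hf⟩
    by_contra hne
    exact absurd (hmin f (Ne.symm hne) hf)
      (sum_abs_cube_le_of_potential _ f _ p hp (hu.trans hf.symm)).not_gt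
  have h2 : Real.sqrt 2 ^ 2 = 2 := Real.sq_sqrt (by norm_num)
  have h5 : Real.sqrt 5 ^ 2 = 5 := Real.sq_sqrt (by norm_num)
  have h2lo : 1.41 < Real.sqrt 2 := Real.lt_sqrt_of_sq_lt (by norm_num)
  have h2hi : Real.sqrt 2 < 1.42 := (Real.sqrt_lt' (by norm_num)).2 (by norm_num)
  have h5lo : 2.23 < Real.sqrt 5 := Real.lt_sqrt_of_sq_lt (by norm_num)
  have h5hi : Real.sqrt 5 < 2.24 := (Real.sqrt_lt' (by norm_num)).2 (by norm_num)
  generalize Real.sqrt 2 = s at *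
  generalize Real.sqrt 5 = t at *
  have hb : |1 - s / 2| = 1 - s / 2 := abs_of_pos (by linarith)
  have ha : |s - 1| = s - 1 := abs_of_pos (by linarith)
  have hnb : |s / 2 - 1| = 1 - s / 2 := by rw [abs_sub_comm, hb]
  have hx : |(5 - t) / 8| = (5 - t) / 8 := abs_of_pos (by linarith)
  have hc : |(t - 1) / 4| = (t - 1) / 4 := abs_of_pos (by linarith)
  have hd : |(1 - t) / 8| = (t - 1) / 8 := by rw [abs_of_neg (by linarith)]; ring
  have hU₁ : fstar ![1, -1, 0, 0] =
      ![s - 1, 1 - s / 2, 1 - s / 2, s / 2 - 1, s / 2 - 1, 0] := by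
    apply key _ _ ![(s - 1) ^ 2, 0, (1 - s / 2) ^ 2, (1 - s / 2) ^ 2]
    · ext i
      fin_cases i <;> simp [K4IncidenceMatrix, Matrix.mulVec, dotProduct, Fin.sum_univ_succ] <;>
        ring
    · intro e
      fin_cases e <;> simp [K4IncidenceMatrix, Matrix.vecMul, dotProduct, Fin.sum_univ_succ,
        ha, hb, hnb] <;> linarith
  have hU₂ : fstar ![1, 0, -1, 0] =
      ![1 - s / 2, s - 1, 1 - s / 2, 1 - s / 2, 0, s / 2 - 1] := by
    apply key _ _ ![(s - 1) ^ 2, (1 - s / 2) ^ 2, 0, (1 - s / 2) ^ 2]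
    · ext i
      fin_cases i <;> simp [K4IncidenceMatrix, Matrix.mulVec, dotProduct, Fin.sum_univ_succ] <;>
        ring
    · intro e
      fin_cases e <;> simp [K4IncidenceMatrix, Matrix.vecMul, dotProduct, Fin.sum_univ_succ,
        ha, hb, hnb] <;> linarith
  have hmid : fstar ((2 : ℝ)⁻¹ • ((![1, -1, 0, 0] : Fin 4 → ℝ) + ![1, 0, -1, 0])) =
      ![(5 - t) / 8, (5 - t) / 8, (t - 1) / 4, 0, (1 - t) / 8, (1 - t) / 8] := by
    apply key _ _ ![((5 - t) / 8) ^ 2, 0, 0, ((t - 1) / 8) ^ 2]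
    · ext i
      fin_cases i <;> simp [K4IncidenceMatrix, Matrix.mulVec, dotProduct, Fin.sum_univ_succ] <;>
        ring
    · intro e
      fin_cases e <;> simp [K4IncidenceMatrix, Matrix.vecMul, dotProduct, Fin.sum_univ_succ,
        hx, hc, hd] <;> linarith
  rw [hU₁, hU₂, hmid]
  refine ⟨hc, by linarith, ?_⟩
  simp [hb]
end
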